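/- arXiv:1705.01926 — 5 statements merged into one kernel-verified Lean document; each statement's English description precedes it below -/
import Mathlib

section
/- Let V be a real symmetric positive definite N×N matrix and ν > 0 with ⟨V x, x⟩ ≥ ν‖x‖² for all x ∈ ℝ^N, and let B : ℝ^N → ℝ^N be β-cocoercive for some β > 0. Then the composition V⁻¹ ∘ B is (βν)-cocoercive with respect to the inner product induced by V; that is, for all x, x' ∈ ℝ^N, ⟨x − x', V⁻¹B(x) − V⁻¹B(x')⟩_V ≥ β ν ‖V⁻¹B(x) − V⁻¹B(x')‖_V², where ⟨u, w⟩_V := ⟨u, V w⟩ and ‖u‖_V := √⟨u, V u⟩. -/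
open Matrix

/-- If `V` is bounded below by `ν ≥ 0` in the sense of quadratic forms, then
`ν ⟨w, V w⟩ ≤ ‖V w‖²`. -/
theorem mul_dotProduct_mulVec_le_of_coercive {n : Type*} [Fintype n] {V : Matrix n n ℝ} {ν : ℝ}
    (hν : 0 ≤ ν) {w : n → ℝ} (hw : ν * (w ⬝ᵥ w) ≤ (V *ᵥ w) ⬝ᵥ w) :
    ν * (w ⬝ᵥ V *ᵥ w) ≤ (V *ᵥ w) ⬝ᵥ (V *ᵥ w) := by
  have hsq : 0 ≤ (V *ᵥ w - ν • w) ⬝ᵥ (V *ᵥ w - ν • w) :=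
    Finset.sum_nonneg fun i _ => mul_self_nonneg _
  simp only [sub_dotProduct, dotProduct_sub, smul_dotProduct, dotProduct_smul, smul_eq_mul,
    dotProduct_comm (V *ᵥ w) w] at hsq hw
  linarith [mul_le_mul_of_nonneg_left hw hν]

/-- Let `V` be a real symmetric positive definite `N×N` matrix and `ν > 0` with
`⟨V x, x⟩ ≥ ν‖x‖²` for all `x`, and let `B` be `β`-cocoercive. Then `V⁻¹ ∘ B` is `(βν)`-cocoercive
w.r.t. the `V`-inner product `⟨u, w⟩_V = ⟨u, V w⟩`. -/
theorem cocoercive_inv_comp {N : ℕ} (V : Matrix (Fin N) (Fin N) ℝ)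
    (hVsymm : V.IsSymm) (hVpd : V.PosDef)
    (ν : ℝ) (hν : 0 < ν)
    (hVν : ∀ x : Fin N → ℝ, ν * (x ⬝ᵥ x) ≤ (V.mulVec x) ⬝ᵥ x)
    (B : (Fin N → ℝ) → (Fin N → ℝ)) (β : ℝ) (hβ : 0 < β)
    (hB : ∀ x y : Fin N → ℝ, β * ((B x - B y) ⬝ᵥ (B x - B y)) ≤ (B x - B y) ⬝ᵥ (x - y)) :
    ∀ x x' : Fin N → ℝ,
      β * ν * ((V⁻¹.mulVec (B x) - V⁻¹.mulVec (B x')) ⬝ᵥ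
          V.mulVec (V⁻¹.mulVec (B x) - V⁻¹.mulVec (B x'))) ≤
        (x - x') ⬝ᵥ V.mulVec (V⁻¹.mulVec (B x) - V⁻¹.mulVec (B x')) := by
  intro x x'
  have hVw : V *ᵥ (V⁻¹ *ᵥ B x - V⁻¹ *ᵥ B x') = B x - B x' := by
    rw [← mulVec_sub, mulVec_mulVec, mul_nonsing_inv V (isUnit_iff_ne_zero.mpr hVpd.det_pos.ne'),
      one_mulVec]
  have hlower := mul_dotProduct_mulVec_le_of_coercive hν.le (hVν (V⁻¹ *ᵥ B x - V⁻¹ *ᵥ B x'))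
  rw [hVw] at hlower ⊢
  rw [mul_assoc, dotProduct_comm (x - x')]
  exact (mul_le_mul_of_nonneg_left hlower hβ.le).trans (hB x x')
end

section
/- Let L : ℝ^n → ℝ^m be a linear map with operator norm ‖L‖, and let γ_R, γ_J > 0 satisfy γ_J γ_R ‖L‖² < 1. Define the linear map 𝒱 on ℝ^n × ℝ^m by 𝒱(x, v) = (x/γ_R − L*v, −L x + v/γ_J), where L* is the adjoint of L. Then 𝒱 is symmetric and ν-positive definite with ν := (1 − √(γ_J γ_R) ‖L‖) · min{1/γ_J, 1/γ_R} > 0; that is, ⟨𝒱(x, v), (x, v)⟩ ≥ ν (‖x‖² + ‖v‖²) for all (x, v) ∈ ℝ^n × ℝ^m. -/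
open scoped RealInnerProductSpace

/-- Young's inequality with weights `1 / a` and `1 / b`. -/
theorem two_mul_le_sqrt_mul_weighted_sq {a b : ℝ} (ha : 0 < a) (hb : 0 < b) (x y : ℝ) :
    2 * (x * y) ≤ Real.sqrt (b * a) * (1 / a * x ^ 2 + 1 / b * y ^ 2) := by
  obtain ⟨p, hp, rfl⟩ : ∃ p : ℝ, 0 < p ∧ p ^ 2 = a :=
    ⟨Real.sqrt a, Real.sqrt_pos.2 ha, Real.sq_sqrt ha.le⟩
  obtain ⟨q, hq, rfl⟩ : ∃ q : ℝ, 0 < q ∧ q ^ 2 = b :=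
    ⟨Real.sqrt b, Real.sqrt_pos.2 hb, Real.sq_sqrt hb.le⟩
  rw [← mul_pow, Real.sqrt_sq (by positivity)]
  have h : 0 ≤ (q * x - p * y) ^ 2 / (p * q) := by positivity
  have e : q * p * (1 / p ^ 2 * x ^ 2 + 1 / q ^ 2 * y ^ 2) - 2 * (x * y) =
      (q * x - p * y) ^ 2 / (p * q) := by
    field_simp
    ring
  linarith

/-- For `L : ℝⁿ → ℝᵐ` linear and `γ_R, γ_J > 0` with `γ_J γ_R ‖L‖² < 1`,
the map `𝒱(x, v) = (x/γ_R − L*v, −L x + v/γ_J)` is symmetric and `ν`-positive definite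
with `ν = (1 − √(γ_J γ_R) ‖L‖) · min{1/γ_J, 1/γ_R} > 0`. -/
theorem preconditioner_symm_posdef {n m : ℕ}
    (L : EuclideanSpace ℝ (Fin n) →L[ℝ] EuclideanSpace ℝ (Fin m))
    (γR γJ : ℝ) (hγR : 0 < γR) (hγJ : 0 < γJ) (hcond : γJ * γR * ‖L‖ ^ 2 < 1) :
    0 < (1 - Real.sqrt (γJ * γR) * ‖L‖) * min (1 / γJ) (1 / γR) ∧
    (∀ (x x' : EuclideanSpace ℝ (Fin n)) (v v' : EuclideanSpace ℝ (Fin m)),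
      ⟪(1 / γR) • x - ContinuousLinearMap.adjoint L v, x'⟫ + ⟪-(L x) + (1 / γJ) • v, v'⟫ =
        ⟪x, (1 / γR) • x' - ContinuousLinearMap.adjoint L v'⟫ +
          ⟪v, -(L x') + (1 / γJ) • v'⟫) ∧
    (∀ (x : EuclideanSpace ℝ (Fin n)) (v : EuclideanSpace ℝ (Fin m)),
      (1 - Real.sqrt (γJ * γR) * ‖L‖) * min (1 / γJ) (1 / γR) * (‖x‖ ^ 2 + ‖v‖ ^ 2) ≤
        ⟪(1 / γR) • x - ContinuousLinearMap.adjoint L v, x⟫ +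
          ⟪-(L x) + (1 / γJ) • v, v⟫) := by
  have hs : Real.sqrt (γJ * γR) * ‖L‖ < 1 := by
    refine lt_of_pow_lt_pow_left₀ 2 zero_le_one ?_
    rw [mul_pow, Real.sq_sqrt (by positivity)]
    simpa using hcond
  refine ⟨mul_pos (sub_pos.2 hs) (by positivity), fun x x' v v' => ?_, fun x v => ?_⟩
  · simp only [inner_sub_left, inner_sub_right, inner_add_left, inner_add_right, inner_neg_left,
      inner_neg_right, real_inner_smul_left, real_inner_smul_right,
      ContinuousLinearMap.adjoint_inner_left, ContinuousLinearMap.adjoint_inner_right]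
    ring
  · simp only [inner_sub_left, inner_add_left, inner_neg_left, real_inner_smul_left,
      ContinuousLinearMap.adjoint_inner_left, real_inner_self_eq_norm_sq]
    rw [real_inner_comm (L x) v]
    have hL : ⟪L x, v⟫ ≤ ‖L‖ * (‖x‖ * ‖v‖) :=
      calc ⟪L x, v⟫ ≤ ‖L x‖ * ‖v‖ := real_inner_le_norm _ _
        _ ≤ ‖L‖ * ‖x‖ * ‖v‖ := by gcongr; exact L.le_opNorm x
        _ = ‖L‖ * (‖x‖ * ‖v‖) := mul_assoc _ _ _
    have hY := mul_le_mul_of_nonneg_left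
      (two_mul_le_sqrt_mul_weighted_sq hγR hγJ ‖x‖ ‖v‖) (norm_nonneg L)
    have hm : min (1 / γJ) (1 / γR) * (‖x‖ ^ 2 + ‖v‖ ^ 2) ≤
        1 / γR * ‖x‖ ^ 2 + 1 / γJ * ‖v‖ ^ 2 := by
      rw [mul_add]
      gcongr
      · exact min_le_right _ _
      · exact min_le_left _ _
    have hν := mul_le_mul_of_nonneg_left hm (sub_pos.2 hs).le
    linarith
end

section
/- Let R : ℝ^n → ℝ ∪ {+∞} and h : ℝ^m → ℝ ∪ {+∞} be proper convex lower semicontinuous, F : ℝ^n → ℝ convex differentiable with β_F-cocoercive gradient, g : ℝ^m → ℝ convex differentiable with β_G-cocoercive gradient (β_F, β_G > 0), L : ℝ^n → ℝ^m linear with adjoint L* and operator norm ‖L‖, and γ_R, γ_J > 0. Assume there exists a Kuhn–Tucker pair, i.e. a pair (x̂, v̂) with −L*v̂ − ∇F(x̂) ∈ ∂R(x̂) and L x̂ − ∇g(v̂) ∈ ∂h(v̂), and assume the step-size condition 2 · min{β_F, β_G} · min{1/γ_J, 1/γ_R} · (1 − √(γ_J γ_R) ‖L‖) > 1. Then for any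 initialization (x₀, v₀), the sequence defined by x_{k+1} = prox_{γ_R R}(x_k − γ_R ∇F(x_k) − γ_R L*v_k), x̄_{k+1} = 2 x_{k+1} − x_k, v_{k+1} = prox_{γ_J h}(v_k − γ_J ∇g(v_k) + γ_J L x̄_{k+1}) converges to some pair (x⋆, v⋆) satisfying −L*v⋆ − ∇F(x⋆) ∈ ∂R(x⋆) and L x⋆ − ∇g(v⋆) ∈ ∂h(v⋆). -/
open scoped RealInnerProductSpace
open Filter Topology

/-- `f : E → ℝ ∪ {+∞}` is proper, convex and lower semicontinuous. -/
def ProperConvexLsc {E : Type*} [NormedAddCommGroup E] [InnerProductSpace ℝ E]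
    (f : E → EReal) : Prop :=
  (∃ x, f x ≠ ⊤) ∧ (∀ x, f x ≠ ⊥) ∧ LowerSemicontinuous f ∧
    ∀ x y : E, ∀ a b : ℝ, 0 ≤ a → 0 ≤ b → a + b = 1 →
      f (a • x + b • y) ≤ (a : EReal) * f x + (b : EReal) * f y

/-- `p = prox_{γ f}(x)`: `p` minimizes `z ↦ ½‖z − x‖² + γ f(z)`. -/
def IsProx {E : Type*} [NormedAddCommGroup E] [InnerProductSpace ℝ E]
    (γ : ℝ) (f : E → EReal) (x p : E) : Prop :=
  ∀ z : E, ((‖p - x‖ ^ 2 / 2 : ℝ) : EReal) + (γ : EReal) * f p ≤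
    ((‖z - x‖ ^ 2 / 2 : ℝ) : EReal) + (γ : EReal) * f z

/-- The subdifferential `∂f(x) = {g | ∀ z, f z ≥ f x + ⟨g, z − x⟩}`. -/
def Subdiff {E : Type*} [NormedAddCommGroup E] [InnerProductSpace ℝ E]
    (f : E → EReal) (x : E) : Set E :=
  {g : E | ∀ z : E, f x + ((⟪g, z - x⟫ : ℝ) : EReal) ≤ f z}

section Subdifferential

variable {E : Type*} [NormedAddCommGroup E] [InnerProductSpace ℝ E]

/-- A proper function is finite wherever it has a subgradient. -/
lemma ne_top_of_mem_subdiff {f : E → EReal} (hf : ProperConvexLsc f) {p u : E}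
    (hu : u ∈ Subdiff f p) : f p ≠ ⊤ := by
  intro htop
  obtain ⟨z, hz⟩ := hf.1
  have h1 := hu z
  rw [htop, EReal.top_add_coe, top_le_iff] at h1
  exact hz h1

/-- The subdifferential is monotone. -/
lemma subdiff_monotone {f : E → EReal} (hf : ProperConvexLsc f) {p q u w : E}
    (hu : u ∈ Subdiff f p) (hw : w ∈ Subdiff f q) : 0 ≤ ⟪u - w, p - q⟫ := by
  have h1 := hu q
  have h2 := hw p
  lift f p to ℝ using ⟨ne_top_of_mem_subdiff hf hu, hf.2.1 p⟩ with a
  lift f q to ℝ using ⟨ne_top_of_mem_subdiff hf hw, hf.2.1 q⟩ with b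
  norm_cast at h1 h2
  have h3 : ⟪u, q - p⟫ = -⟪u, p - q⟫ := by rw [← inner_neg_right, neg_sub]
  rw [inner_sub_left]
  linarith

/-- The residual of a proximal step is a subgradient at the proximal point. -/
lemma IsProx.mem_subdiff {f : E → EReal} (hf : ProperConvexLsc f) {γ : ℝ} (hγ : 0 < γ)
    {x p : E} (hp : IsProx γ f x p) : γ⁻¹ • (x - p) ∈ Subdiff f p := by
  have hptop : f p ≠ ⊤ := by
    intro htop
    obtain ⟨z, hz⟩ := hf.1
    have h1 := hp z
    have hzb := hf.2.1 z
    rw [htop, EReal.coe_mul_top_of_pos hγ, EReal.coe_add_top, top_le_iff] at h1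
    lift f z to ℝ using ⟨hz, hzb⟩ with b
    norm_cast at h1
    exact EReal.coe_ne_top _ h1
  intro z
  by_cases hz : f z = ⊤
  · rw [hz]; exact le_top
  obtain ⟨a, ha⟩ : ∃ a : ℝ, (a : EReal) = f p :=
    ⟨_, EReal.coe_toReal hptop (hf.2.1 p)⟩
  obtain ⟨b, hb⟩ : ∃ b : ℝ, (b : EReal) = f z :=
    ⟨_, EReal.coe_toReal hz (hf.2.1 z)⟩
  have key : ∀ t : ℝ, 0 < t → t < 1 →
      0 ≤ ⟪p - x, z - p⟫ + γ * (b - a) + t * (‖z - p‖ ^ 2 / 2) := by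
    intro t ht ht1
    have h1 := hp ((1 - t) • p + t • z)
    have h2 := hf.2.2.2 p z (1 - t) t (by linarith) ht.le (by ring)
    have h3 := hf.2.1 ((1 - t) • p + t • z)
    rw [← ha, ← hb] at h2
    rw [← ha] at h1
    norm_cast at h2
    obtain ⟨c, hc⟩ : ∃ c : ℝ, (c : EReal) = f ((1 - t) • p + t • z) :=
      ⟨_, EReal.coe_toReal (ne_top_of_le_ne_top (EReal.coe_ne_top _) h2) h3⟩
    rw [← hc] at h1 h2
    norm_cast at h1 h2
    have h4 : (1 - t) • p + t • z - x = (p - x) + t • (z - p) := by module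
    rw [h4, norm_add_sq_real, inner_smul_right, norm_smul, Real.norm_of_nonneg ht.le] at h1
    have h5 := mul_le_mul_of_nonneg_left h2 hγ.le
    refine nonneg_of_mul_nonneg_right (a := t) ?_ ht
    nlinarith
  have hlim : Tendsto (fun t : ℝ => ⟪p - x, z - p⟫ + γ * (b - a) + t * (‖z - p‖ ^ 2 / 2))
      (𝓝[>] 0) (𝓝 (⟪p - x, z - p⟫ + γ * (b - a) + 0 * (‖z - p‖ ^ 2 / 2))) :=
    tendsto_nhdsWithin_of_tendsto_nhds (Continuous.tendsto (by fun_prop) 0)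
  have hge := ge_of_tendsto hlim (by
    filter_upwards [Ioo_mem_nhdsGT (zero_lt_one' ℝ)] with t ht using key t ht.1 ht.2)
  rw [← ha, ← hb]
  norm_cast
  have h6 : ⟪x - p, z - p⟫ = -⟪p - x, z - p⟫ := by rw [← inner_neg_left, neg_sub]
  have h7 : γ⁻¹ * ⟪x - p, z - p⟫ ≤ b - a := by
    rw [inv_mul_le_iff₀ hγ]; linarith
  rw [real_inner_smul_left]
  linarith

/-- The graph of the subdifferential is sequentially closed. -/
lemma mem_subdiff_of_tendsto {f : E → EReal} (hf : ProperConvexLsc f) {p u : ℕ → E} {p' u' : E}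
    (hp : Tendsto p atTop (𝓝 p')) (hu : Tendsto u atTop (𝓝 u'))
    (hmem : ∀ k, u k ∈ Subdiff f (p k)) : u' ∈ Subdiff f p' := by
  intro z
  by_cases hz : f z = ⊤
  · rw [hz]; exact le_top
  obtain ⟨b, hb⟩ : ∃ b : ℝ, (b : EReal) = f z :=
    ⟨_, EReal.coe_toReal hz (hf.2.1 z)⟩
  have hle : ∀ k, f (p k) ≤ ((b - ⟪u k, z - p k⟫ : ℝ) : EReal) := by
    intro k
    have h1 := hmem k z
    have h2 := ne_top_of_mem_subdiff hf (hmem k)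
    have h3 := hf.2.1 (p k)
    rw [← hb] at h1
    lift f (p k) to ℝ using ⟨h2, h3⟩ with a
    norm_cast at h1 ⊢
    linarith
  have hc : Tendsto (fun k => ((b - ⟪u k, z - p k⟫ : ℝ) : EReal)) atTop
      (𝓝 ((b - ⟪u', z - p'⟫ : ℝ) : EReal)) :=
    (continuous_coe_real_ereal.tendsto _).comp
      (tendsto_const_nhds.sub (hu.inner (tendsto_const_nhds.sub hp)))
  have hfin : f p' ≤ ((b - ⟪u', z - p'⟫ : ℝ) : EReal) := by
    by_contra! hlt
    obtain ⟨y, hy1, hy2⟩ := exists_between hlt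
    obtain ⟨k, hk1, hk2⟩ :=
      ((hp.eventually (hf.2.2.1 p' y hy2)).and (hc.eventually_lt_const hy1)).exists
    exact absurd (hk1.trans_le (hle k)) hk2.not_gt
  rw [← hb]
  have h3 := hf.2.1 p'
  lift f p' to ℝ using ⟨ne_top_of_le_ne_top (EReal.coe_ne_top _) hfin, h3⟩ with a
  norm_cast at hfin ⊢
  linarith

/-- A map that is `β`-cocoercive is continuous. -/
lemma continuous_of_cocoercive {B : E → E} {β : ℝ} (hβ : 0 < β)
    (hB : ∀ a b, β * ‖B a - B b‖ ^ 2 ≤ ⟪B a - B b, a - b⟫) : Continuous B := by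
  refine (LipschitzWith.of_dist_le_mul (K := β⁻¹.toNNReal) fun a b => ?_).continuous
  rw [dist_eq_norm, dist_eq_norm, Real.coe_toNNReal _ (inv_pos.2 hβ).le, le_inv_mul_iff₀ hβ]
  have h1 := (hB a b).trans (real_inner_le_norm _ _)
  rcases (norm_nonneg (B a - B b)).eq_or_lt with h0 | h0
  · rw [← h0]; simp
  · nlinarith

/-- Young's inequality for the error of an explicit step of a cocoercive map. -/
lemma cocoercive_explicit_step_le {β : ℝ} (hβ : 0 < β) {w d e : E}
    (hw : β * ‖w‖ ^ 2 ≤ ⟪w, d⟫) : -(2 * ⟪w, d - e⟫) ≤ 1 / (2 * β) * ‖e‖ ^ 2 := by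
  rw [inner_sub_right]
  have h1 := real_inner_le_norm w e
  have h2 : 2 * (‖w‖ * ‖e‖) ≤ 2 * β * ‖w‖ ^ 2 + 1 / (2 * β) * ‖e‖ ^ 2 := by
    have : 2 * β * ‖w‖ ^ 2 + 1 / (2 * β) * ‖e‖ ^ 2 - 2 * (‖w‖ * ‖e‖)
        = 1 / (2 * β) * (2 * β * ‖w‖ - ‖e‖) ^ 2 := by field_simp; ring
    have : 0 ≤ 1 / (2 * β) * (2 * β * ‖w‖ - ‖e‖) ^ 2 := by positivity
    linarith
  linarith

end Subdifferential

/-- Two sequences vanish if the sum of their squared norms does. -/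
lemma tendsto_zero_of_norm_sq_add {X V : Type*} [SeminormedAddCommGroup X]
    [SeminormedAddCommGroup V] {a : ℕ → X} {b : ℕ → V}
    (hab : Tendsto (fun k => ‖a k‖ ^ 2 + ‖b k‖ ^ 2) atTop (𝓝 0)) :
    Tendsto a atTop (𝓝 0) ∧ Tendsto b atTop (𝓝 0) := by
  have hsqrt := (Real.continuous_sqrt.tendsto 0).comp hab
  rw [Real.sqrt_zero] at hsqrt
  constructor
  · refine squeeze_zero_norm (fun k => Real.le_sqrt_of_sq_le ?_) hsqrt
    exact le_add_of_nonneg_right (sq_nonneg _)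
  · refine squeeze_zero_norm (fun k => Real.le_sqrt_of_sq_le ?_) hsqrt
    exact le_add_of_nonneg_left (sq_nonneg _)

section PrimalDual

variable {X V : Type*} [NormedAddCommGroup X] [InnerProductSpace ℝ X]
  [NormedAddCommGroup V] [InnerProductSpace ℝ V]

/-- The squared norm on `X × V` in which the primal–dual iteration is a forward–backward one. -/
noncomputable def primalDualSqNorm (L : X →L[ℝ] V) (γR γJ : ℝ) (a : X) (b : V) : ℝ :=
  1 / γR * ‖a‖ ^ 2 - 2 * ⟪L a, b⟫ + 1 / γJ * ‖b‖ ^ 2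

/-- The primal–dual metric dominates the Euclidean one. -/
lemma primalDualSqNorm_ge (L : X →L[ℝ] V) {γR γJ : ℝ} (hγR : 0 < γR) (hγJ : 0 < γJ)
    (hs : 0 ≤ 1 - √(γJ * γR) * ‖L‖) (a : X) (b : V) :
    min (1 / γJ) (1 / γR) * (1 - √(γJ * γR) * ‖L‖) * (‖a‖ ^ 2 + ‖b‖ ^ 2)
      ≤ primalDualSqNorm L γR γJ a b := by
  have h1 : ⟪L a, b⟫ ≤ ‖L‖ * ‖a‖ * ‖b‖ := (real_inner_le_norm _ _).trans
    (mul_le_mul_of_nonneg_right (L.le_opNorm a) (norm_nonneg _))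
  have h2 : 2 * (‖a‖ * ‖b‖) ≤ √(γJ * γR) * (1 / γR * ‖a‖ ^ 2 + 1 / γJ * ‖b‖ ^ 2) := by
    rw [Real.sqrt_mul hγJ.le]
    have hr : 0 < √γR := Real.sqrt_pos.2 hγR
    have hj : 0 < √γJ := Real.sqrt_pos.2 hγJ
    have hr2 : γR = √γR ^ 2 := (Real.sq_sqrt hγR.le).symm
    have hj2 : γJ = √γJ ^ 2 := (Real.sq_sqrt hγJ.le).symm
    generalize √γR = r at *
    generalize √γJ = j at *
    subst hr2 hj2
    have : j * r * (1 / r ^ 2 * ‖a‖ ^ 2 + 1 / j ^ 2 * ‖b‖ ^ 2) - 2 * (‖a‖ * ‖b‖)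
        = 1 / (r * j) * (j * ‖a‖ - r * ‖b‖) ^ 2 := by field_simp; ring
    have : 0 ≤ 1 / (r * j) * (j * ‖a‖ - r * ‖b‖) ^ 2 := by positivity
    linarith
  have h3 := mul_le_mul_of_nonneg_left h2 (norm_nonneg L)
  have h4 : min (1 / γJ) (1 / γR) * (‖a‖ ^ 2 + ‖b‖ ^ 2) ≤ 1 / γR * ‖a‖ ^ 2 + 1 / γJ * ‖b‖ ^ 2 := by
    have := mul_le_mul_of_nonneg_right (min_le_left (1 / γJ) (1 / γR)) (sq_nonneg ‖b‖)
    have := mul_le_mul_of_nonneg_right (min_le_right (1 / γJ) (1 / γR)) (sq_nonneg ‖a‖)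
    linarith
  have h5 := mul_le_mul_of_nonneg_left h4 hs
  unfold primalDualSqNorm
  linarith

/-- Three-point identity for the primal–dual metric, with the cross terms arranged as they occur
in one iteration. -/
lemma primalDualSqNorm_three_point [CompleteSpace X] [CompleteSpace V] (L : X →L[ℝ] V) (γR γJ : ℝ)
    (x x' y : X) (v v' w : V) :
    2 * (⟪γR⁻¹ • (x - x') - ContinuousLinearMap.adjoint L (v - w), x' - y⟫
      + ⟪γJ⁻¹ • (v - v') + L ((2 : ℝ) • x' - x - y), v' - w⟫)
      = primalDualSqNorm L γR γJ (x - y) (v - w) - primalDualSqNorm L γR γJ (x' - y) (v' - w)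
        - primalDualSqNorm L γR γJ (x - x') (v - v') := by
  obtain ⟨d, rfl⟩ : ∃ d, x = x' + d := ⟨x - x', by abel⟩
  obtain ⟨a, rfl⟩ : ∃ a, x' = y + a := ⟨x' - y, by abel⟩
  obtain ⟨e, rfl⟩ : ∃ e, v = v' + e := ⟨v - v', by abel⟩
  obtain ⟨b, rfl⟩ : ∃ b, v' = w + b := ⟨v' - w, by abel⟩
  have e1 : y + a + d - (y + a) = d := by abel
  have e2 : w + b + e - w = b + e := by abel
  have e3 : y + a - y = a := by abel
  have e4 : w + b + e - (w + b) = e := by abel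
  have e5 : (2 : ℝ) • (y + a) - (y + a + d) - y = a - d := by module
  have e6 : w + b - w = b := by abel
  have e7 : y + a + d - y = a + d := by abel
  rw [e1, e2, e3, e4, e5, e6, e7]
  unfold primalDualSqNorm
  rw [norm_add_sq_real, norm_add_sq_real, inner_sub_left, ContinuousLinearMap.adjoint_inner_left]
  simp only [map_add, map_sub, inner_add_left, inner_add_right, inner_sub_left,
    real_inner_smul_left, one_div]
  rw [real_inner_comm d a, real_inner_comm e b, real_inner_comm (L a) b, real_inner_comm (L a) e]
  ring

/-- One primal–dual iteration is Fejér monotone with respect to Kuhn–Tucker pairs. -/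
lemma primalDual_fejer [CompleteSpace X] [CompleteSpace V] {R : X → EReal} {h : V → EReal}
    (hR : ProperConvexLsc R) (hh : ProperConvexLsc h) {A : X → X} {B : V → V} {β : ℝ} (hβ : 0 < β)
    (hA : ∀ a b, β * ‖A a - A b‖ ^ 2 ≤ ⟪A a - A b, a - b⟫)
    (hB : ∀ a b, β * ‖B a - B b‖ ^ 2 ≤ ⟪B a - B b, a - b⟫)
    (L : X →L[ℝ] V) {γR γJ : ℝ} {x x' y : X} {v v' w : V}
    (hx : γR⁻¹ • (x - x') - A x - ContinuousLinearMap.adjoint L v ∈ Subdiff R x')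
    (hv : γJ⁻¹ • (v - v') - B v + L ((2 : ℝ) • x' - x) ∈ Subdiff h v')
    (hy : -(ContinuousLinearMap.adjoint L w) - A y ∈ Subdiff R y)
    (hw : L y - B w ∈ Subdiff h w) :
    primalDualSqNorm L γR γJ (x' - y) (v' - w) + primalDualSqNorm L γR γJ (x - x') (v - v')
      ≤ primalDualSqNorm L γR γJ (x - y) (v - w)
        + 1 / (2 * β) * (‖x - x'‖ ^ 2 + ‖v - v'‖ ^ 2) := by
  have m1 := subdiff_monotone hR hx hy
  have m2 := subdiff_monotone hh hv hw
  have c1 := cocoercive_explicit_step_le (e := x - x') hβ (hA x y)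
  have c2 := cocoercive_explicit_step_le (e := v - v') hβ (hB v w)
  have id := primalDualSqNorm_three_point L γR γJ x x' y v v' w
  have r1 : γR⁻¹ • (x - x') - A x - ContinuousLinearMap.adjoint L v
      - (-(ContinuousLinearMap.adjoint L w) - A y)
      = (γR⁻¹ • (x - x') - ContinuousLinearMap.adjoint L (v - w)) - (A x - A y) := by
    rw [map_sub]; abel
  have r2 : γJ⁻¹ • (v - v') - B v + L ((2 : ℝ) • x' - x) - (L y - B w)
      = (γJ⁻¹ • (v - v') + L ((2 : ℝ) • x' - x - y)) - (B v - B w) := by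
    rw [map_sub L _ y]; abel
  rw [sub_sub_sub_cancel_left] at c1 c2
  rw [r1, inner_sub_left] at m1
  rw [r2, inner_sub_left] at m2
  linarith

/-- Convergence of the primal–dual iteration for cocoercive operators in finite dimension. -/
lemma primalDual_tendsto [FiniteDimensional ℝ X] [FiniteDimensional ℝ V]
    [CompleteSpace X] [CompleteSpace V] {R : X → EReal} {h : V → EReal}
    (hR : ProperConvexLsc R) (hh : ProperConvexLsc h) {A : X → X} {B : V → V} {β : ℝ} (hβ : 0 < β)
    (hA : ∀ a b, β * ‖A a - A b‖ ^ 2 ≤ ⟪A a - A b, a - b⟫)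
    (hB : ∀ a b, β * ‖B a - B b‖ ^ 2 ≤ ⟪B a - B b, a - b⟫)
    (L : X →L[ℝ] V) {γR γJ : ℝ} {μ : ℝ} (hμ : 1 / (2 * β) < μ)
    (hQ : ∀ a b, μ * (‖a‖ ^ 2 + ‖b‖ ^ 2) ≤ primalDualSqNorm L γR γJ a b)
    (hKT : ∃ y w, -(ContinuousLinearMap.adjoint L w) - A y ∈ Subdiff R y ∧
      L y - B w ∈ Subdiff h w)
    {x : ℕ → X} {v : ℕ → V}
    (hx : ∀ k, γR⁻¹ • (x k - x (k + 1)) - A (x k) - ContinuousLinearMap.adjoint L (v k)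
      ∈ Subdiff R (x (k + 1)))
    (hv : ∀ k, γJ⁻¹ • (v k - v (k + 1)) - B (v k) + L ((2 : ℝ) • x (k + 1) - x k)
      ∈ Subdiff h (v (k + 1))) :
    ∃ xs vs, Tendsto x atTop (𝓝 xs) ∧ Tendsto v atTop (𝓝 vs) ∧
      -(ContinuousLinearMap.adjoint L vs) - A xs ∈ Subdiff R xs ∧ L xs - B vs ∈ Subdiff h vs := by
  have : ProperSpace X := FiniteDimensional.proper ℝ X
  have : ProperSpace V := FiniteDimensional.proper ℝ V
  have hμ0 : 0 < μ := lt_trans (by positivity) hμ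
  have hε : 0 < μ - 1 / (2 * β) := sub_pos.2 hμ
  have hQ0 : ∀ a b, 0 ≤ primalDualSqNorm L γR γJ a b :=
    fun a b => le_trans (by positivity) (hQ a b)
  have fejer : ∀ y w, -(ContinuousLinearMap.adjoint L w) - A y ∈ Subdiff R y →
      L y - B w ∈ Subdiff h w → ∀ k,
      primalDualSqNorm L γR γJ (x (k + 1) - y) (v (k + 1) - w)
        + (μ - 1 / (2 * β)) * (‖x k - x (k + 1)‖ ^ 2 + ‖v k - v (k + 1)‖ ^ 2)
        ≤ primalDualSqNorm L γR γJ (x k - y) (v k - w) := by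
    intro y w hy hw k
    have h1 := primalDual_fejer hR hh hβ hA hB L (hx k) (hv k) hy hw
    have h2 := hQ (x k - x (k + 1)) (v k - v (k + 1))
    linarith
  have anti : ∀ y w, -(ContinuousLinearMap.adjoint L w) - A y ∈ Subdiff R y →
      L y - B w ∈ Subdiff h w →
      Antitone fun k => primalDualSqNorm L γR γJ (x k - y) (v k - w) := by
    intro y w hy hw
    refine antitone_nat_of_succ_le fun k => le_trans ?_ (fejer y w hy hw k)
    exact le_add_of_nonneg_right (by positivity)
  obtain ⟨y, w, hy, hw⟩ := hKT
  have hdiff : Tendsto (fun k => ‖x k - x (k + 1)‖ ^ 2 + ‖v k - v (k + 1)‖ ^ 2) atTop (𝓝 0) := by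
    have hconv := tendsto_atTop_ciInf (anti y w hy hw)
      ⟨0, by rintro _ ⟨k, rfl⟩; exact hQ0 _ _⟩
    have hgap := (hconv.sub (hconv.comp (tendsto_add_atTop_nat 1))).const_mul
      (μ - 1 / (2 * β))⁻¹
    rw [sub_self, mul_zero] at hgap
    refine squeeze_zero (fun k => by positivity) (fun k => ?_) hgap
    rw [le_inv_mul_iff₀ hε]
    have := fejer y w hy hw k
    simp only [Function.comp_apply]
    linarith
  obtain ⟨hdx, hdv⟩ := tendsto_zero_of_norm_sq_add hdiff
  obtain ⟨r, hr⟩ : ∃ r, ∀ k, ‖x k - y‖ ^ 2 + ‖v k - w‖ ^ 2 ≤ r ^ 2 := by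
    refine ⟨√(μ⁻¹ * primalDualSqNorm L γR γJ (x 0 - y) (v 0 - w)), fun k => ?_⟩
    rw [Real.sq_sqrt (mul_nonneg (inv_nonneg.2 hμ0.le) (hQ0 _ _)), le_inv_mul_iff₀ hμ0]
    exact (hQ _ _).trans (anti y w hy hw (Nat.zero_le k))
  have hball : ∀ k, (x k, v k) ∈ Metric.closedBall (y, w) |r| := by
    intro k
    rw [Metric.mem_closedBall, Prod.dist_eq, max_le_iff, dist_eq_norm, dist_eq_norm]
    have := hr k
    constructor <;> refine le_abs_self _ |>.trans (sq_le_sq.1 ?_) <;>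
      nlinarith [sq_nonneg ‖x k - y‖, sq_nonneg ‖v k - w‖]
  obtain ⟨⟨xs, vs⟩, -, φ, hφ, hlim⟩ :=
    tendsto_subseq_of_bounded Metric.isBounded_closedBall hball
  have hxφ : Tendsto (fun k => x (φ k)) atTop (𝓝 xs) := (continuous_fst.tendsto _).comp hlim
  have hvφ : Tendsto (fun k => v (φ k)) atTop (𝓝 vs) := (continuous_snd.tendsto _).comp hlim
  have hdxφ := hdx.comp hφ.tendsto_atTop
  have hdvφ := hdv.comp hφ.tendsto_atTop
  have hxφ' : Tendsto (fun k => x (φ k + 1)) atTop (𝓝 xs) := by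
    simpa using hxφ.sub hdxφ
  have hvφ' : Tendsto (fun k => v (φ k + 1)) atTop (𝓝 vs) := by
    simpa using hvφ.sub hdvφ
  have hxs : -(ContinuousLinearMap.adjoint L vs) - A xs ∈ Subdiff R xs := by
    refine mem_subdiff_of_tendsto hR hxφ' ?_ fun k => hx (φ k)
    have := ((hdxφ.const_smul γR⁻¹).sub
      (((continuous_of_cocoercive hβ hA).tendsto xs).comp hxφ)).sub
      (((ContinuousLinearMap.adjoint L).continuous.tendsto vs).comp hvφ)
    convert this using 1
    congr 1
    rw [smul_zero, zero_sub, neg_sub_comm]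
  have hvs : L xs - B vs ∈ Subdiff h vs := by
    refine mem_subdiff_of_tendsto hh hvφ' ?_ fun k => hv (φ k)
    have := ((hdvφ.const_smul γJ⁻¹).sub
      (((continuous_of_cocoercive hβ hB).tendsto vs).comp hvφ)).add
      ((L.continuous.tendsto _).comp ((hxφ'.const_smul (2 : ℝ)).sub hxφ))
    convert this using 1
    congr 1
    rw [smul_zero, two_smul, add_sub_cancel_right, zero_sub, neg_add_eq_sub]
  have hq : Tendsto (fun k => primalDualSqNorm L γR γJ (x k - xs) (v k - vs)) atTop (𝓝 0) := by
    refine (tendsto_iff_tendsto_subseq_of_antitone (anti xs vs hxs hvs) hφ.tendsto_atTop).2 ?_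
    have hcont : Continuous fun z : X × V => primalDualSqNorm L γR γJ (z.1 - xs) (z.2 - vs) := by
      unfold primalDualSqNorm; fun_prop
    have := (hcont.tendsto (xs, vs)).comp hlim
    simpa [primalDualSqNorm, Function.comp_def] using this
  have hsq : Tendsto (fun k => ‖x k - xs‖ ^ 2 + ‖v k - vs‖ ^ 2) atTop (𝓝 0) := by
    have hq' := hq.const_mul μ⁻¹
    rw [mul_zero] at hq'
    refine squeeze_zero (fun k => by positivity) (fun k => ?_) hq'
    rw [le_inv_mul_iff₀ hμ0]
    exact hQ _ _
  obtain ⟨hxlim, hvlim⟩ := tendsto_zero_of_norm_sq_add hsq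
  exact ⟨xs, vs, tendsto_sub_nhds_zero_iff.1 hxlim, tendsto_sub_nhds_zero_iff.1 hvlim, hxs, hvs⟩

end PrimalDual

/-- Global convergence of the unrelaxed Primal–Dual splitting method (θ = 1):
under existence of a Kuhn–Tucker pair and the step-size condition, the iterates converge to a
Kuhn–Tucker pair. -/
theorem primal_dual_global_convergence {n m : ℕ}
    (R : EuclideanSpace ℝ (Fin n) → EReal) (h : EuclideanSpace ℝ (Fin m) → EReal)
    (hR : ProperConvexLsc R) (hh : ProperConvexLsc h)
    (F : EuclideanSpace ℝ (Fin n) → ℝ) (g : EuclideanSpace ℝ (Fin m) → ℝ)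
    (hFconv : ConvexOn ℝ Set.univ F) (hgconv : ConvexOn ℝ Set.univ g)
    (hF : Differentiable ℝ F) (hg : Differentiable ℝ g)
    (βF βG : ℝ) (hβF : 0 < βF) (hβG : 0 < βG)
    (hFcoco : ∀ a b : EuclideanSpace ℝ (Fin n),
      βF * ‖gradient F a - gradient F b‖ ^ 2 ≤ ⟪gradient F a - gradient F b, a - b⟫)
    (hgcoco : ∀ a b : EuclideanSpace ℝ (Fin m),
      βG * ‖gradient g a - gradient g b‖ ^ 2 ≤ ⟪gradient g a - gradient g b, a - b⟫)
    (L : EuclideanSpace ℝ (Fin n) →L[ℝ] EuclideanSpace ℝ (Fin m))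
    (γR γJ : ℝ) (hγR : 0 < γR) (hγJ : 0 < γJ)
    (hKT : ∃ (xh : EuclideanSpace ℝ (Fin n)) (vh : EuclideanSpace ℝ (Fin m)),
      -(ContinuousLinearMap.adjoint L vh) - gradient F xh ∈ Subdiff R xh ∧
        L xh - gradient g vh ∈ Subdiff h vh)
    (hstep : 1 < 2 * min βF βG * min (1 / γJ) (1 / γR) * (1 - Real.sqrt (γJ * γR) * ‖L‖))
    (x : ℕ → EuclideanSpace ℝ (Fin n)) (v : ℕ → EuclideanSpace ℝ (Fin m))
    (hx : ∀ k : ℕ, IsProx γR R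
      (x k - γR • gradient F (x k) - γR • ContinuousLinearMap.adjoint L (v k)) (x (k + 1)))
    (hv : ∀ k : ℕ, IsProx γJ h
      (v k - γJ • gradient g (v k) + γJ • L ((2 : ℝ) • x (k + 1) - x k)) (v (k + 1))) :
    ∃ (xs : EuclideanSpace ℝ (Fin n)) (vs : EuclideanSpace ℝ (Fin m)),
      Tendsto x atTop (nhds xs) ∧ Tendsto v atTop (nhds vs) ∧
      -(ContinuousLinearMap.adjoint L vs) - gradient F xs ∈ Subdiff R xs ∧
      L xs - gradient g vs ∈ Subdiff h vs := by
  have hβ : 0 < min βF βG := lt_min hβF hβG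
  have hγ : 0 < min (1 / γJ) (1 / γR) := lt_min (by positivity) (by positivity)
  have hs : 0 < 1 - √(γJ * γR) * ‖L‖ :=
    pos_of_mul_pos_right (zero_lt_one.trans hstep) (by positivity)
  refine primalDual_tendsto hR hh hβ
    (fun a b => (mul_le_mul_of_nonneg_right (min_le_left _ _) (sq_nonneg _)).trans (hFcoco a b))
    (fun a b => (mul_le_mul_of_nonneg_right (min_le_right _ _) (sq_nonneg _)).trans (hgcoco a b))
    L (γR := γR) (γJ := γJ) ?_ (primalDualSqNorm_ge L hγR hγJ hs.le) hKT ?_ ?_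
  · rw [div_lt_iff₀ (by positivity)]
    linarith
  · intro k
    convert (hx k).mem_subdiff hR hγR using 1
    match_scalars <;> field_simp
  · intro k
    convert (hv k).mem_subdiff hh hγJ using 1
    match_scalars <;> field_simp
end

section
/- Let L̄ ∈ ℝ^{m×n} have rank l with nonzero singular values σ_1, …, σ_l (counted with multiplicity), let γ_R, γ_J > 0 and θ ∈ ℝ, and define M = [[Id_n, −γ_R L̄ᵀ], [γ_J L̄, Id_m − (1+θ) γ_R γ_J L̄ L̄ᵀ]] ∈ ℝ^{(n+m)×(n+m)}. Then for every ρ ∈ ℂ, det(M − ρ Id_{n+m}) = (1 − ρ)^{n+m−2l} · ∏_{j=1}^{l} ( ρ² − (2 − (1+θ) γ_J γ_R σ_j²) ρ + (1 − θ γ_J γ_R σ_j²) ). -/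
open Matrix

theorem Matrix.IsHermitian.det_one_sub_smul_map {n : ℕ} {A : Matrix (Fin n) (Fin n) ℝ}
    (hA : A.IsHermitian) (s : ℂ) :
    (1 - s • A.map (algebraMap ℝ ℂ)).det = ∏ i, (1 - s * (hA.eigenvalues i : ℂ)) := by
  rcases eq_or_ne s 0 with rfl | hs
  · simp
  have h : (A.map (algebraMap ℝ ℂ)).charpoly.eval s⁻¹ =
      ∏ i, (s⁻¹ - (hA.eigenvalues i : ℂ)) := by
    rw [Matrix.charpoly_map, hA.charpoly_eq]
    simp [Polynomial.eval_map, Polynomial.eval₂_finsetProd]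
  rw [Matrix.eval_charpoly] at h
  have h1 : (1 - s • A.map (algebraMap ℝ ℂ)) =
      s • (scalar (Fin n) s⁻¹ - A.map (algebraMap ℝ ℂ)) := by
    rw [smul_sub]
    congr 1
    ext i j
    rcases eq_or_ne i j with rfl | hij <;> simp [*]
  rw [h1, det_smul, h, Fintype.card, ← Finset.prod_const, ← Finset.prod_mul_distrib]
  refine Finset.prod_congr rfl fun i _ => ?_
  field_simp

/-- The determinant of a block matrix with scalar top-left block `u`, via the Schur complement. -/
theorem Matrix.det_fromBlocks_smul_one_sub_smul_mul {K : Type*} [Field K] {n m : ℕ}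
    (B : Matrix (Fin m) (Fin n) K) (C : Matrix (Fin n) (Fin m) K) (a c k u : K) (hu : u ≠ 0) :
    (fromBlocks (u • (1 : Matrix (Fin n) (Fin n) K)) (-a • C) (c • B)
      (u • (1 : Matrix (Fin m) (Fin m) K) - k • (B * C))).det =
    u ^ (n + m) * (1 - ((k - a * c / u) / u) • (C * B)).det := by
  have hB : fromBlocks (u • (1 : Matrix (Fin n) (Fin n) K)) (-a • C) (c • B)
      (u • (1 : Matrix (Fin m) (Fin m) K) - k • (B * C)) =
      u • fromBlocks 1 ((-a / u) • C) ((c / u) • B) (1 - (k / u) • (B * C)) := by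
    rw [fromBlocks_smul]
    congr 1 <;> simp [smul_sub, smul_smul, mul_div_cancel₀, hu]
  rw [hB, det_smul, det_fromBlocks_one₁₁]
  have h : 1 - (k / u) • (B * C) - ((c / u) • B) * ((-a / u) • C) =
      1 - B * (((k - a * c / u) / u) • C) := by
    simp only [Matrix.smul_mul, Matrix.mul_smul, smul_smul, sub_sub, ← add_smul]
    congr 2
    field_simp
    ring
  rw [h, det_one_sub_mul_comm, Matrix.smul_mul]
  simp

open scoped Classical in
/-- Characteristic polynomial factorization for the Primal–Dual iteration
matrix: with `l = rank L̄` and the nonzero singular values `σ_j` of `L̄` (i.e. `σ_j²` are the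
nonzero eigenvalues of `L̄ᵀL̄`, with multiplicity),
`det(M − ρId) = (1−ρ)^{n+m−2l} ∏_j (ρ² − (2 − (1+θ)γ_J γ_R σ_j²)ρ + (1 − θγ_J γ_R σ_j²))`. -/
theorem primal_dual_charpoly_factorization {n m : ℕ}
    (Lb : Matrix (Fin m) (Fin n) ℝ) (l : ℕ) (γR γJ θ : ℝ)
    (hγR : 0 < γR) (hγJ : 0 < γJ)
    (hrank : Lb.rank = l)
    (hHerm : (Lbᵀ * Lb).IsHermitian)
    (hl : (Finset.univ.filter fun i => hHerm.eigenvalues i ≠ 0).card = l) :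
    ∀ ρ : ℂ,
      Matrix.det
          ((fromBlocks (1 : Matrix (Fin n) (Fin n) ℝ) (-γR • Lbᵀ) (γJ • Lb)
              ((1 : Matrix (Fin m) (Fin m) ℝ) -
                ((1 + θ) * γR * γJ) • (Lb * Lbᵀ))).map (algebraMap ℝ ℂ) -
            ρ • (1 : Matrix (Fin n ⊕ Fin m) (Fin n ⊕ Fin m) ℂ)) =
        (1 - ρ) ^ (n + m - 2 * l) *
          ∏ i ∈ Finset.univ.filter fun i => hHerm.eigenvalues i ≠ 0,
            (ρ ^ 2 - ((2 : ℂ) - ((1 : ℂ) + (θ : ℂ)) * (γJ : ℂ) * (γR : ℂ) *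
                ((hHerm.eigenvalues i : ℝ) : ℂ)) * ρ +
              (1 - (θ : ℂ) * (γJ : ℂ) * (γR : ℂ) * ((hHerm.eigenvalues i : ℝ) : ℂ))) := by
  have hlm : l ≤ m := hrank ▸ by simpa using Lb.rank_le_height
  have hln : l ≤ n := hrank ▸ by simpa using Lb.rank_le_width
  rw [← funext_iff]
  refine Continuous.ext_on (dense_compl_singleton (1 : ℂ)) ?_ ?_ ?_
  · exact Continuous.matrix_det (by fun_prop)
  · fun_prop
  intro ρ hρ
  have hu : 1 - ρ ≠ 0 := sub_ne_zero.mpr (Ne.symm hρ)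
  have hM : (fromBlocks (1 : Matrix (Fin n) (Fin n) ℝ) (-γR • Lbᵀ) (γJ • Lb)
              ((1 : Matrix (Fin m) (Fin m) ℝ) -
                ((1 + θ) * γR * γJ) • (Lb * Lbᵀ))).map (algebraMap ℝ ℂ) -
            ρ • (1 : Matrix (Fin n ⊕ Fin m) (Fin n ⊕ Fin m) ℂ) =
      fromBlocks ((1 - ρ) • (1 : Matrix (Fin n) (Fin n) ℂ))
        (-(γR : ℂ) • Lbᵀ.map (algebraMap ℝ ℂ)) ((γJ : ℂ) • Lb.map (algebraMap ℝ ℂ))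
        ((1 - ρ) • (1 : Matrix (Fin m) (Fin m) ℂ) - ((1 + θ) * γR * γJ : ℂ) •
          (Lb.map (algebraMap ℝ ℂ) * Lbᵀ.map (algebraMap ℝ ℂ))) := by
    rw [← Matrix.map_mul]
    ext (i | i) (j | j)
    · simp [Matrix.one_apply]
      split_ifs <;> simp
    · simp
    · simp
    · simp [Matrix.one_apply]
      split_ifs <;> simp <;> ring
  have hexp : n + m = n + m - 2 * l + 2 * l := by omega
  simp only
  rw [hM, det_fromBlocks_smul_one_sub_smul_mul _ _ _ _ _ _ hu, ← Matrix.map_mul,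
    hHerm.det_one_sub_smul_map, hexp, pow_add, mul_assoc]
  simp only [Nat.add_sub_cancel]
  congr 1
  rw [← Finset.prod_filter_of_ne (p := fun i => hHerm.eigenvalues i ≠ 0)
    (fun i _ h h0 => h (by simp [h0])), pow_mul, ← hl, ← Finset.prod_const,
    ← Finset.prod_mul_distrib]
  refine Finset.prod_congr rfl fun i _ => ?_
  field_simp
  ring
end

section
/- Let J : ℝ^n → ℝ ∪ {+∞} be proper convex lower semicontinuous with Legendre–Fenchel conjugate J*, and let γ > 0. Given x_{k−1}, x_k ∈ ℝ^n and v_k ∈ ℝ^n, set x̄_k = 2x_k − x_{k−1}, v_{k+1} = prox_{(1/γ) J*}( v_k + (1/γ) x̄_k ), z_k = x_{k−1} − γ v_k, z_{k+1} = x_k − γ v_{k+1}, and u_{k+1} = prox_{γ J}(2 x_k − z_k). Then z_{k+1} = z_k + u_{k+1} − x_k; that is, the Primal–Dual update with γ_J = 1/γ_R = 1/γ coincides with the Douglas–Rachford update. -/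
open scoped RealInnerProductSpace

/-- A real number dominated by arbitrarily small multiples of a fixed real is nonpositive. -/
lemma nonpos_of_forall_le_mul {A B : ℝ} (h : ∀ t : ℝ, 0 < t → t < 1 → A ≤ t * B) : A ≤ 0 := by
  by_contra! hA
  have hB : 0 < |B| + A := by positivity
  have h1 : A / (2 * (|B| + A)) < 1 := by
    rw [div_lt_one (by positivity)]
    nlinarith [abs_nonneg B]
  have h2 := h (A / (2 * (|B| + A))) (by positivity) h1
  rw [div_mul_eq_mul_div, le_div_iff₀ (by positivity)] at h2
  nlinarith [le_abs_self B, abs_nonneg B, mul_le_mul_of_nonneg_left (le_abs_self B) hA.le,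
    mul_nonneg hA.le (abs_nonneg B), mul_pos hA hA]

section Prox

variable {E : Type*} [NormedAddCommGroup E] [InnerProductSpace ℝ E]

/-- A proximal point of a function lies in its domain as soon as the domain is nonempty. -/
lemma IsProx.ne_top {f : E → EReal} {γ : ℝ} (hγ : 0 < γ) {x p x₀ : E} (hp : IsProx γ f x p)
    (hx₀ : f x₀ ≠ ⊤) (hbot : f x₀ ≠ ⊥) : f p ≠ ⊤ := by
  intro htop
  have h := hp x₀
  lift f x₀ to ℝ using ⟨hx₀, hbot⟩ with r
  rw [htop, EReal.coe_mul_top_of_pos hγ, EReal.coe_add_top, ← EReal.coe_mul, ← EReal.coe_add,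
    top_le_iff] at h
  exact EReal.coe_ne_top _ h

/-- The defining inequality of a proximal point, at points where the function is finite. -/
lemma IsProx.le_real {f : E → EReal} {γ : ℝ} {x p z : E} {a b : ℝ} (hp : IsProx γ f x p)
    (ha : f p = a) (hb : f z = b) :
    ‖p - x‖ ^ 2 / 2 + γ * a ≤ ‖z - x‖ ^ 2 / 2 + γ * b := by
  have h := hp z
  rw [ha, hb] at h
  exact_mod_cast h

/-- Variational characterization: if `p = prox_{γ f}(x)` then `(x - p) / γ` is a subgradient
of `f` at `p`. -/
lemma IsProx.inner_sub_le {f : E → EReal} (hf : ProperConvexLsc f) {γ : ℝ} (hγ : 0 < γ)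
    {x p z : E} {a b : ℝ} (hp : IsProx γ f x p) (ha : f p = a) (hb : f z = b) :
    ⟪z - p, x - p⟫ ≤ γ * (b - a) := by
  obtain ⟨-, hbot, -, hconv⟩ := hf
  rw [← sub_nonpos]
  refine nonpos_of_forall_le_mul (B := ‖z - p‖ ^ 2 / 2) fun t ht ht1 => ?_
  have hc := hconv p z (1 - t) t (by linarith) ht.le (by ring)
  rw [ha, hb, ← EReal.coe_mul, ← EReal.coe_mul, ← EReal.coe_add] at hc
  obtain ⟨c, hfc⟩ : ∃ c : ℝ, f ((1 - t) • p + t • z) = c :=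
    ⟨_, (EReal.coe_toReal (ne_top_of_le_ne_top (EReal.coe_ne_top _) hc) (hbot _)).symm⟩
  rw [hfc, EReal.coe_le_coe_iff] at hc
  have hmin := hp.le_real ha hfc
  have hsplit : (1 - t) • p + t • z - x = t • (z - p) - (x - p) := by module
  rw [hsplit, norm_sub_sq_real (t • (z - p)), norm_smul, real_inner_smul_left, mul_pow, Real.norm_eq_abs,
    sq_abs, norm_sub_rev p x] at hmin
  have hγc := mul_le_mul_of_nonneg_left hc hγ.le
  have key : t * (⟪z - p, x - p⟫ - γ * (b - a)) ≤ t * (t * (‖z - p‖ ^ 2 / 2)) := by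
    linarith
  exact le_of_mul_le_mul_left key ht

/-- Moreau identity: if `p = prox_{γ f}(x)` and `q = prox_{f* / γ}(x / γ)`, then
`p + γ q = x`. -/
lemma IsProx.moreau {f g : E → EReal} (hf : ProperConvexLsc f)
    (hg : ∀ y : E, g y = ⨆ v : E, (((⟪v, y⟫ : ℝ) : EReal) - f v)) {γ : ℝ} (hγ : 0 < γ)
    {x p q : E} (hp : IsProx γ f x p) (hq : IsProx (1 / γ) g ((1 / γ) • x) q) :
    p + γ • q = x := by
  obtain ⟨x₀, hx₀⟩ := hf.1
  have hbot := hf.2.1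
  obtain ⟨a, ha⟩ : ∃ a : ℝ, f p = a :=
    ⟨_, (EReal.coe_toReal (hp.ne_top hγ hx₀ (hbot _)) (hbot _)).symm⟩
  have hlow (y : E) : ((⟪p, y⟫ - a : ℝ) : EReal) ≤ g y := by
    rw [hg, EReal.coe_sub, ← ha]
    exact le_iSup (fun v : E => ((⟪v, y⟫ : ℝ) : EReal) - f v) p
  have hgbot (y : E) : g y ≠ ⊥ := ne_bot_of_le_ne_bot (EReal.coe_ne_bot _) (hlow y)
  set s : E := (1 / γ) • (x - p) with hs
  have hup : g s ≤ ((⟪p, s⟫ - a : ℝ) : EReal) := by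
    rw [hg]
    refine iSup_le fun v => ?_
    rcases eq_or_ne (f v) ⊤ with hv | hv
    · simp [hv]
    · obtain ⟨b, hb⟩ : ∃ b : ℝ, f v = b := ⟨_, (EReal.coe_toReal hv (hbot _)).symm⟩
      have h := hp.inner_sub_le hf hγ ha hb
      rw [hb, ← EReal.coe_sub, EReal.coe_le_coe_iff]
      have h' : ⟪v - p, s⟫ ≤ b - a := by
        rw [hs, real_inner_smul_right, one_div, inv_mul_le_iff₀ hγ]
        exact h
      rw [inner_sub_left] at h'
      linarith
  have hgs : g s = ((⟪p, s⟫ - a : ℝ) : EReal) := le_antisymm hup (hlow s)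
  obtain ⟨c, hc⟩ : ∃ c : ℝ, g q = c :=
    ⟨_, (EReal.coe_toReal (hq.ne_top (by positivity) (hgs ▸ EReal.coe_ne_top _) (hgbot s))
      (hgbot q)).symm⟩
  have hmin := hq.le_real hc hgs
  have hlq := hlow q
  rw [hc, EReal.coe_le_coe_iff] at hlq
  have h1 : q - (1 / γ) • x = (q - s) - (1 / γ) • p := by rw [hs]; module
  have h2 : s - (1 / γ) • x = -((1 / γ) • p) := by rw [hs]; module
  rw [h1, h2, norm_neg, norm_sub_sq_real, real_inner_smul_right, inner_sub_left,
    real_inner_comm p q, real_inner_comm p s] at hmin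
  have hlq' := mul_le_mul_of_nonneg_left hlq (one_div_pos.2 hγ).le
  have hzero : ‖q - s‖ ^ 2 ≤ 0 := by linarith
  have hqs : q = s := by
    rw [← sub_eq_zero, ← norm_eq_zero]
    exact pow_eq_zero_iff (two_ne_zero) |>.1 (le_antisymm hzero (sq_nonneg _))
  rw [hqs, hs, smul_smul, mul_one_div_cancel hγ.ne', one_smul, add_sub_cancel]

end Prox

/-- With `γ_J = 1/γ_R = 1/γ`, the Primal–Dual update coincides with the
Douglas–Rachford update: `z_{k+1} = z_k + u_{k+1} − x_k`. -/
theorem primal_dual_eq_douglas_rachford {n : ℕ}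
    (J Jstar : EuclideanSpace ℝ (Fin n) → EReal)
    (hJ : ProperConvexLsc J)
    (hconj : ∀ y : EuclideanSpace ℝ (Fin n),
      Jstar y = ⨆ v : EuclideanSpace ℝ (Fin n), (((⟪v, y⟫ : ℝ) : EReal) - J v))
    (γ : ℝ) (hγ : 0 < γ)
    (xprev xk u' : EuclideanSpace ℝ (Fin n)) (vk v' : EuclideanSpace ℝ (Fin n))
    (hv : IsProx (1 / γ) Jstar (vk + (1 / γ) • ((2 : ℝ) • xk - xprev)) v')
    (hu : IsProx γ J ((2 : ℝ) • xk - (xprev - γ • vk)) u') :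
    xk - γ • v' = (xprev - γ • vk) + u' - xk := by
  have hx : vk + (1 / γ) • ((2 : ℝ) • xk - xprev) =
      (1 / γ) • ((2 : ℝ) • xk - (xprev - γ • vk)) := by
    have hvk : (1 / γ) • γ • vk = vk := by
      rw [smul_smul, one_div_mul_cancel hγ.ne', one_smul]
    rw [← sub_add, smul_add, hvk, add_comm]
  rw [hx] at hv
  have h := IsProx.moreau hJ hconj hγ hu hv
  rw [← eq_sub_iff_add_eq'] at h
  rw [h]
  module
end
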